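/- arXiv:1512.06325 — 7 statements merged into one kernel-verified Lean document; each statement's English description precedes it below -/
import Mathlib

section
/- For every integer m ≥ 1, the vector φ₋ = (1, 1−λ₋, λ₋−1, −1)ᵀ⊗𝟙 ∈ ℝ^{4m} satisfies L_* φ₋ = λ₋ φ₋, where λ₋ = m + 1 − √(m² + 1). -/
open Matrix Polynomial

/-- `lamMinus m` is the eigenvalue `m + 1 - sqrt (m^2 + 1)`. -/
noncomputable def lamMinus (m : ℕ) : ℝ := m + 1 - Real.sqrt ((m : ℝ) ^ 2 + 1)

/-- The matrix `L_*` on `ℝ^{4m}`, indexed by pairs `(b, p)` where `b : Fin 4` is the block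
index and `p : Fin m` is the position within the block.  In 4×4 block form with m×m blocks,
`L_* = [[I, -I, 0, 0], [-I, (m+1)I, -J, 0], [0, -J, (m+1)I, -I], [0, 0, -I, I]]`,
where `J` is the all-ones matrix. -/
def Lstar (m : ℕ) : Matrix (Fin 4 × Fin m) (Fin 4 × Fin m) ℝ := fun i j =>
  if i.1 = j.1 then
    (if i.1.val = 0 ∨ i.1.val = 3 then (if i.2 = j.2 then 1 else 0)
     else ((m : ℝ) + 1) * (if i.2 = j.2 then 1 else 0))
  else if (i.1.val = 0 ∧ j.1.val = 1) ∨ (i.1.val = 1 ∧ j.1.val = 0) ∨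
          (i.1.val = 2 ∧ j.1.val = 3) ∨ (i.1.val = 3 ∧ j.1.val = 2) then
    (if i.2 = j.2 then -1 else 0)
  else if (i.1.val = 1 ∧ j.1.val = 2) ∨ (i.1.val = 2 ∧ j.1.val = 1) then -1
  else 0

/-- `tensor c ξ` is the vector `(c 0, c 1, c 2, c 3)ᵀ ⊗ ξ` in `ℝ^{4m}`:
its four consecutive blocks of length `m` are `c 0 • ξ`, `c 1 • ξ`, `c 2 • ξ`, `c 3 • ξ`. -/
def tensor {m : ℕ} (c : Fin 4 → ℝ) (ξ : Fin m → ℝ) : Fin 4 × Fin m → ℝ := fun i => c i.1 * ξ i.2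

/-- For every integer `m ≥ 1`, the vector `φ₋ = (1, 1-λ₋, λ₋-1, -1)ᵀ ⊗ 𝟙`
satisfies `L_* φ₋ = λ₋ φ₋`, where `λ₋ = m + 1 - √(m² + 1)`. -/
theorem stmt0 (m : ℕ) (hm : 1 ≤ m) :
    (Lstar m).mulVec (tensor ![1, 1 - lamMinus m, lamMinus m - 1, -1] (fun _ => 1)) =
      lamMinus m • (tensor ![1, 1 - lamMinus m, lamMinus m - 1, -1] (fun _ => 1)) := by
  have hl : lamMinus m ^ 2 = (2 * m + 2) * lamMinus m - 2 * m := by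
    have h := Real.sq_sqrt (show (0 : ℝ) ≤ (m : ℝ) ^ 2 + 1 by positivity)
    unfold lamMinus
    linear_combination h
  generalize lamMinus m = l at hl ⊢
  ext ⟨b, p⟩
  simp only [Matrix.mulVec, dotProduct, Fintype.sum_prod_type, Fin.sum_univ_four, Pi.smul_apply,
    smul_eq_mul]
  fin_cases b <;> simp [Lstar, tensor] <;>
    first | done | (linear_combination hl) | (linear_combination -hl) | ring
end

section
/- For every integer m ≥ 1 and every ξ ∈ ℝ^m with ⟨ξ, 𝟙⟩ = 0, the vectors (1, 1−μ₋, 0, 0)ᵀ⊗ξ and (0, 0, 1−μ₋, 1)ᵀ⊗ξ in ℝ^{4m} are eigenvectors of L_* with eigenvalue μ₋ = m/2 + 1 − √(m²/4 + 1). -/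
open Matrix Polynomial

/-- `muMinus m` is the eigenvalue `m/2 + 1 - sqrt (m^2/4 + 1)`. -/
noncomputable def muMinus (m : ℕ) : ℝ := (m : ℝ) / 2 + 1 - Real.sqrt ((m : ℝ) ^ 2 / 4 + 1)

theorem muMinus_eq (m : ℕ) : (1 - muMinus m) * ((m : ℝ) + 1 - muMinus m) = 1 := by
  have h := Real.sq_sqrt (show (0 : ℝ) ≤ (m : ℝ) ^ 2 / 4 + 1 by positivity)
  unfold muMinus
  linear_combination h

/-- For every integer `m ≥ 1` and every nonzero `ξ ∈ ℝ^m` with `⟨ξ, 𝟙⟩ = 0`, the vectors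
`(1, 1-μ₋, 0, 0)ᵀ ⊗ ξ` and `(0, 0, 1-μ₋, 1)ᵀ ⊗ ξ` are eigenvectors of `L_*` with
eigenvalue `μ₋ = m/2 + 1 - √(m²/4 + 1)`. -/
theorem stmt3 (m : ℕ) (hm : 1 ≤ m) (ξ : Fin m → ℝ) (hξ : ∑ k, ξ k = 0) (hξ0 : ξ ≠ 0) :
    ((Lstar m).mulVec (tensor ![1, 1 - muMinus m, 0, 0] ξ) =
        muMinus m • tensor ![1, 1 - muMinus m, 0, 0] ξ ∧
      tensor ![1, 1 - muMinus m, 0, 0] ξ ≠ 0) ∧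
    ((Lstar m).mulVec (tensor ![0, 0, 1 - muMinus m, 1] ξ) =
        muMinus m • tensor ![0, 0, 1 - muMinus m, 1] ξ ∧
      tensor ![0, 0, 1 - muMinus m, 1] ξ ≠ 0) := by
  have hμ := muMinus_eq m
  generalize muMinus m = μ at hμ ⊢
  obtain ⟨k, hk⟩ := Function.ne_iff.mp hξ0
  have hs : ∀ c : ℝ, ∑ k, c * ξ k = 0 := fun c => by rw [← Finset.mul_sum, hξ, mul_zero]
  refine ⟨⟨?_, fun h => hk ?_⟩, ⟨?_, fun h => hk ?_⟩⟩
  · ext ⟨b, p⟩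
    fin_cases b <;>
      simp [Matrix.mulVec, dotProduct, Fintype.sum_prod_type, Fin.sum_univ_four, Lstar, tensor, hs, hξ]
    · ring
    · linear_combination ξ p * hμ
  · simpa [tensor] using congrFun h (0, k)
  · ext ⟨b, p⟩
    fin_cases b <;>
      simp [Matrix.mulVec, dotProduct, Fintype.sum_prod_type, Fin.sum_univ_four, Lstar, tensor, hs, hξ]
    · linear_combination ξ p * hμ
    · ring
  · simpa [tensor] using congrFun h (3, k)
end

section
/- For every integer m ≥ 1 and every ξ ∈ ℝ^m with ⟨ξ, 𝟙⟩ = 0, the vectors (1, 1−μ₊, 0, 0)ᵀ⊗ξ and (0, 0, 1−μ₊, 1)ᵀ⊗ξ in ℝ^{4m} are eigenvectors of L_* with eigenvalue μ₊ = m/2 + 1 + √(m²/4 + 1). -/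
open Matrix Polynomial

/-- `muPlus m` is the eigenvalue `m/2 + 1 + sqrt (m^2/4 + 1)`. -/
noncomputable def muPlus (m : ℕ) : ℝ := (m : ℝ) / 2 + 1 + Real.sqrt ((m : ℝ) ^ 2 / 4 + 1)

theorem muPlus_quad (m : ℕ) : muPlus m ^ 2 = ((m : ℝ) + 2) * muPlus m - m := by
  have h : Real.sqrt ((m : ℝ) ^ 2 / 4 + 1) ^ 2 = (m : ℝ) ^ 2 / 4 + 1 :=
    Real.sq_sqrt (by positivity)
  unfold muPlus
  linear_combination h

theorem Lstar_mulVec_tensor (m : ℕ) (c : Fin 4 → ℝ) (ξ : Fin m → ℝ) (hξ : ∑ k, ξ k = 0) :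
    (Lstar m).mulVec (tensor c ξ) =
      tensor ![c 0 - c 1, -c 0 + ((m : ℝ) + 1) * c 1, ((m : ℝ) + 1) * c 2 - c 3, -c 2 + c 3] ξ := by
  have hs : ∀ a : ℝ, ∑ k, a * ξ k = 0 := fun a => by rw [← Finset.mul_sum, hξ, mul_zero]
  funext ⟨b, p⟩
  simp only [Matrix.mulVec, dotProduct, Fintype.sum_prod_type, Fin.sum_univ_four]
  fin_cases b <;> simp [Lstar, tensor, hs] <;> ring

/-- For every integer `m ≥ 1` and every nonzero `ξ ∈ ℝ^m` with `⟨ξ, 𝟙⟩ = 0`, the vectors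
`(1, 1-μ₊, 0, 0)ᵀ ⊗ ξ` and `(0, 0, 1-μ₊, 1)ᵀ ⊗ ξ` are eigenvectors of `L_*` with
eigenvalue `μ₊ = m/2 + 1 + √(m²/4 + 1)`. -/
theorem stmt4 (m : ℕ) (hm : 1 ≤ m) (ξ : Fin m → ℝ) (hξ : ∑ k, ξ k = 0) (hξ0 : ξ ≠ 0) :
    ((Lstar m).mulVec (tensor ![1, 1 - muPlus m, 0, 0] ξ) =
        muPlus m • tensor ![1, 1 - muPlus m, 0, 0] ξ ∧
      tensor ![1, 1 - muPlus m, 0, 0] ξ ≠ 0) ∧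
    ((Lstar m).mulVec (tensor ![0, 0, 1 - muPlus m, 1] ξ) =
        muPlus m • tensor ![0, 0, 1 - muPlus m, 1] ξ ∧
      tensor ![0, 0, 1 - muPlus m, 1] ξ ≠ 0) := by
  have hq := muPlus_quad m
  obtain ⟨k, hk⟩ := Function.ne_iff.mp hξ0
  refine ⟨⟨?_, ?_⟩, ⟨?_, ?_⟩⟩
  · rw [Lstar_mulVec_tensor m _ ξ hξ]
    funext ⟨b, p⟩
    fin_cases b <;> simp [tensor]
    linear_combination ξ p * hq
  · intro h
    have := congrFun h (0, k)
    simp [tensor] at this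
    exact hk this
  · rw [Lstar_mulVec_tensor m _ ξ hξ]
    funext ⟨b, p⟩
    fin_cases b <;> simp [tensor]
    linear_combination ξ p * hq
  · intro h
    have := congrFun h (3, k)
    simp [tensor] at this
    exact hk this
end

section
/- For every integer m ≥ 2, the characteristic polynomial of L_* equals x(x − 2)(x − λ₋)(x − λ₊)[(x − μ₋)(x − μ₊)]^{m−1}·[(x − μ₋)(x − μ₊)]^{m−1}, i.e., the eigenvalues of L_* counted with multiplicity are: 0 with multiplicity 1, λ₋ = m+1−√(m²+1) with multiplicity 1, λ₊ = m+1+√(m²+1) with multiplicity 1, μ₋ = m/2+1−√(m²/4+1) with multiplicity 2m−2, μ₊ = m/2+1+√(m²/4+1) with multiplicity 2m−2, and 2 with multiplicity 1. -/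
open Matrix Polynomial

/-- `lamPlus m` is the eigenvalue `m + 1 + sqrt (m^2 + 1)`. -/
noncomputable def lamPlus (m : ℕ) : ℝ := m + 1 + Real.sqrt ((m : ℝ) ^ 2 + 1)

open scoped Kronecker

noncomputable def blkA (m : ℕ) : Matrix (Fin 4) (Fin 4) ℝ :=
  !![1, -1, 0, 0; -1, (m : ℝ) + 1, 0, 0; 0, 0, (m : ℝ) + 1, -1; 0, 0, -1, 1]

noncomputable def blkB : Matrix (Fin 4) (Fin 4) ℝ :=
  !![0, 0, 0, 0; 0, 0, -1, 0; 0, -1, 0, 0; 0, 0, 0, 0]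

noncomputable def allOnes (k : ℕ) : Matrix (Fin k) (Fin k) ℝ := Matrix.of fun _ _ => 1

noncomputable def changeP (k : ℕ) : Matrix (Fin (k + 1)) (Fin (k + 1)) ℝ :=
  Matrix.of fun i j => if i = 0 then 1 else (if i = j then 1 else 0) - (if j = 0 then 1 else 0)

noncomputable def diagD (k : ℕ) : Fin (k + 1) → ℝ := fun i => if i = 0 then (k : ℝ) + 1 else 0

lemma Lstar_eq (m : ℕ) : Lstar m = blkA m ⊗ₖ (1 : Matrix (Fin m) (Fin m) ℝ) + blkB ⊗ₖ allOnes m := by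
  ext ⟨a, i⟩ ⟨b, j⟩
  fin_cases a <;> fin_cases b <;>
    simp [Lstar, blkA, blkB, allOnes, Matrix.one_apply]

lemma changeP_mul (k : ℕ) :
    changeP k * allOnes (k + 1) = Matrix.diagonal (diagD k) * changeP k := by
  ext i j
  rw [Matrix.diagonal_mul, Matrix.mul_apply]
  by_cases hi : i = 0
  · simp [changeP, allOnes, diagD, hi]
  · simp [changeP, allOnes, diagD, hi]

lemma changeP_det (k : ℕ) : (changeP k).det ≠ 0 := by
  intro h
  obtain ⟨v, hv, h0⟩ := Matrix.exists_mulVec_eq_zero_iff.mpr h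
  apply hv
  have h1 : ∀ i, v i = v 0 := by
    intro i
    by_cases hi : i = 0
    · rw [hi]
    · have := congrFun h0 i
      simp [changeP, Matrix.mulVec, dotProduct, hi, sub_mul, Finset.sum_sub_distrib] at this
      linarith
  have h2 := congrFun h0 0
  simp [changeP, Matrix.mulVec, dotProduct] at h2
  rw [Finset.sum_congr rfl (fun i _ => h1 i)] at h2
  simp at h2
  have h3 : v 0 = 0 := by
    rcases h2 with h2 | h2
    · exfalso
      have : (0 : ℝ) ≤ k := Nat.cast_nonneg k
      linarith
    · exact h2
  funext i
  rw [h1 i, h3]; rfl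

lemma charpoly_of_intertwine {n : Type*} [Fintype n] [DecidableEq n] (Q A B : Matrix n n ℝ)
    (hQ : Q.det ≠ 0) (h : Q * A = B * Q) : A.charpoly = B.charpoly := by
  have hu : IsUnit Q := (Matrix.isUnit_iff_isUnit_det Q).mpr (isUnit_iff_ne_zero.mpr hQ)
  obtain ⟨u, rfl⟩ := hu
  have : B = u.val * A * u⁻¹.val := by
    rw [h, mul_assoc]; simp
  rw [this]
  have h2 := Matrix.charpoly_units_conj u A
  rw [← Matrix.coe_units_inv] at h2
  exact h2.symm

lemma charpoly_blockDiag (k : ℕ) (M : Fin k → Matrix (Fin 4) (Fin 4) ℝ) :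
    (Matrix.blockDiagonal M).charpoly = ∏ i, (M i).charpoly := by
  unfold Matrix.charpoly
  rw [← Matrix.det_blockDiagonal]
  congr 1
  ext1 ⟨a, i⟩ ⟨b, j⟩
  by_cases h : i = j
  · subst h
    by_cases hab : a = b <;>
    simp [Matrix.charmatrix_apply, Matrix.blockDiagonal_apply, Matrix.diagonal_apply, hab]
  · simp [Matrix.charmatrix_apply, Matrix.blockDiagonal_apply, h]

lemma kron_eq_blockDiag (m k : ℕ) (d : Fin k → ℝ) :
    blkA m ⊗ₖ (1 : Matrix (Fin k) (Fin k) ℝ) + blkB ⊗ₖ Matrix.diagonal d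
      = Matrix.blockDiagonal (fun i => blkA m + d i • blkB) := by
  ext ⟨a, i⟩ ⟨b, j⟩
  by_cases h : i = j
  · subst h
    simp [Matrix.blockDiagonal_apply, mul_comm]
  · simp [Matrix.blockDiagonal_apply, h]

lemma charpoly_blk (m : ℕ) (d : ℝ) : (blkA m + d • blkB).charpoly =
    ((X - 1) * (X - C ((m : ℝ) + 1)) - 1) ^ 2 - (C d * (X - 1)) ^ 2 := by
  have : blkA m + d • blkB =
    !![1, -1, 0, 0; -1, (m : ℝ) + 1, -d, 0; 0, -d, (m : ℝ) + 1, -1; 0, 0, -1, 1] := by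
    ext a b
    fin_cases a <;> fin_cases b <;> simp [blkA, blkB]
  have h2 : Matrix.charmatrix (!![1, -1, 0, 0; -1, (m : ℝ) + 1, -d, 0; 0, -d, (m : ℝ) + 1, -1;
      0, 0, -1, 1] : Matrix (Fin 4) (Fin 4) ℝ) =
      !![X - 1, 1, 0, 0; 1, X - C ((m : ℝ) + 1), C d, 0; 0, C d, X - C ((m : ℝ) + 1), 1;
        0, 0, 1, X - 1] := by
    ext1 a b
    fin_cases a <;> fin_cases b <;> simp [Matrix.charmatrix_apply]
  rw [this, Matrix.charpoly, h2]
  generalize C ((m : ℝ) + 1) = c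
  generalize C d = e
  rw [Matrix.det_succ_row_zero]
  simp [Fin.sum_univ_succ, Matrix.det_fin_three, Fin.succAbove]
  ring

lemma mu_mul (m : ℕ) : (X - C (muMinus m)) * (X - C (muPlus m)) =
    (X - 1) * (X - C ((m : ℝ) + 1)) - 1 := by
  have hs : muMinus m + muPlus m = m + 2 := by unfold muMinus muPlus; ring
  have hp : muMinus m * muPlus m = m := by
    have := Real.sq_sqrt (show (0 : ℝ) ≤ (m : ℝ) ^ 2 / 4 + 1 by positivity)
    unfold muMinus muPlus; linear_combination -this
  have hs' := congrArg C hs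
  have hp' := congrArg C hp
  simp only [map_add, map_mul, map_one, C_ofNat] at hs' hp' ⊢
  linear_combination -X * hs' + hp'

lemma lam_mul (m : ℕ) : (X - C (lamMinus m)) * (X - C (lamPlus m)) =
    X ^ 2 - 2 * C ((m : ℝ) + 1) * X + 2 * C (m : ℝ) := by
  have hs : lamMinus m + lamPlus m = 2 * (m + 1) := by unfold lamMinus lamPlus; ring
  have hp : lamMinus m * lamPlus m = 2 * m := by
    have := Real.sq_sqrt (show (0 : ℝ) ≤ (m : ℝ) ^ 2 + 1 by positivity)
    unfold lamMinus lamPlus; linear_combination -this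
  have hs' := congrArg C hs
  have hp' := congrArg C hp
  simp only [map_add, map_mul, map_one, C_ofNat] at hs' hp' ⊢
  linear_combination -X * hs' + hp'

lemma charpoly_Lstar (k : ℕ) : (Lstar (k + 1)).charpoly =
    ∏ i, (blkA (k + 1) + diagD k i • blkB).charpoly := by
  rw [← charpoly_blockDiag, ← kron_eq_blockDiag]
  apply charpoly_of_intertwine ((1 : Matrix (Fin 4) (Fin 4) ℝ) ⊗ₖ changeP k)
  · rw [Matrix.det_kronecker]
    simp [changeP_det]
  · rw [Lstar_eq, mul_add, add_mul]
    simp only [← Matrix.mul_kronecker_mul, changeP_mul, one_mul, mul_one]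

/-- For every integer `m ≥ 2`, the characteristic polynomial of `L_*` equals
`x (x-2) (x-λ₋) (x-λ₊) [(x-μ₋)(x-μ₊)]^{m-1} · [(x-μ₋)(x-μ₊)]^{m-1}`; i.e. the
eigenvalues of `L_*` counted with multiplicity are `0, 2, λ₋, λ₊` each with multiplicity `1`
and `μ₋, μ₊` each with multiplicity `2m - 2`. -/
theorem stmt5 (m : ℕ) (hm : 2 ≤ m) :
    (Lstar m).charpoly =
      X * (X - C 2) * (X - C (lamMinus m)) * (X - C (lamPlus m)) *
        (((X - C (muMinus m)) * (X - C (muPlus m))) ^ (m - 1) *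
          ((X - C (muMinus m)) * (X - C (muPlus m))) ^ (m - 1)) := by
  obtain ⟨k, rfl⟩ : ∃ k, m = k + 1 := ⟨m - 1, by omega⟩
  rw [charpoly_Lstar, Fin.prod_univ_succ, mul_assoc X, mul_assoc (X * _), mul_assoc X]
  simp only [charpoly_blk, diagD, Fin.succ_ne_zero, if_true, if_false, mu_mul, Finset.prod_const,
    Finset.card_univ, Fintype.card_fin, Nat.add_sub_cancel]
  have h := lam_mul (k + 1)
  simp only [mul_assoc] at h ⊢
  rw [← mul_assoc (X - C (lamMinus _)), h]
  simp only [Nat.cast_add, Nat.cast_one, map_add, map_one, map_zero, C_ofNat,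
    zero_mul, ne_eq, OfNat.ofNat_ne_zero, not_false_eq_true, zero_pow, sub_zero]
  rw [pow_right_comm]
  generalize ((X - 1) * (X - (C (k : ℝ) + 1 + 1)) - 1) ^ k = w
  ring
end

section
/- Let G₁, G₂, G₃, G₄ be simple connected undirected graphs, each on m vertices, with Laplacians L₁, …, L₄, let L₀ = diag(L₁, L₂, L₃, L₄) and L = L₀ + L_*. Then the vector φ₋ = (1, 1−λ₋, λ₋−1, −1)ᵀ⊗𝟙 satisfies L φ₋ = λ₋ φ₋, where λ₋ = m + 1 − √(m² + 1). -/
open Matrix Polynomial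

/-- The block-diagonal matrix `diag(Ls 0, Ls 1, Ls 2, Ls 3)` on `ℝ^{4m}`. -/
def blockDiag4 {m : ℕ} (Ls : Fin 4 → Matrix (Fin m) (Fin m) ℝ) :
    Matrix (Fin 4 × Fin m) (Fin 4 × Fin m) ℝ := fun i j =>
  if i.1 = j.1 then Ls i.1 i.2 j.2 else 0

/-- Let `G₁, G₂, G₃, G₄` be simple connected graphs on `m` vertices with Laplacians
`L₁, …, L₄`, let `L₀ = diag(L₁, L₂, L₃, L₄)` and `L = L₀ + L_*`.  Then
`L φ₋ = λ₋ φ₋` for `φ₋ = (1, 1-λ₋, λ₋-1, -1)ᵀ ⊗ 𝟙`. -/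
theorem stmt7 (m : ℕ) (hm : 1 ≤ m) (G : Fin 4 → SimpleGraph (Fin m))
    [∀ k, DecidableRel (G k).Adj] (hconn : ∀ k, (G k).Connected)
    (L : Matrix (Fin 4 × Fin m) (Fin 4 × Fin m) ℝ)
    (hL : L = blockDiag4 (fun k => SimpleGraph.lapMatrix ℝ (G k)) + Lstar m) :
    L.mulVec (tensor ![1, 1 - lamMinus m, lamMinus m - 1, -1] (fun _ => 1)) = lamMinus m • (tensor ![1, 1 - lamMinus m, lamMinus m - 1, -1] (fun _ => 1)) := by
  have hq : lamMinus m ^ 2 = (2 * m + 2) * lamMinus m - 2 * m := by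
    have h := Real.sq_sqrt (show (0 : ℝ) ≤ (m : ℝ) ^ 2 + 1 by positivity)
    unfold lamMinus
    nlinarith [h]
  have hlap : ∀ k p, ∑ x, SimpleGraph.lapMatrix ℝ (G k) p x = 0 := by
    intro k p
    have h := congrFun (SimpleGraph.lapMatrix_mulVec_const_eq_zero (R := ℝ) (G k)) p
    simpa [Matrix.mulVec, dotProduct] using h
  generalize lamMinus m = l at *
  subst hL
  ext ⟨b, p⟩
  simp only [Matrix.mulVec, dotProduct, Fintype.sum_prod_type, Fin.sum_univ_four, tensor,
    Matrix.add_apply, blockDiag4, Lstar, Pi.smul_apply, smul_eq_mul, mul_one, add_mul,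
    Finset.sum_add_distrib, ← Finset.sum_mul]
  fin_cases b <;> simp [hlap, Finset.sum_add_distrib] <;> nlinarith [hq]
end

section
/- For every integer m ≥ 1 and every v ∈ ℝ^{4m} each of whose four consecutive blocks of length m is orthogonal to 𝟙 ∈ ℝ^m, one has ⟨L_* v, v⟩ ≥ μ₋ ⟨v, v⟩, where μ₋ = m/2 + 1 − √(m²/4 + 1). -/
open Matrix Polynomial

/-- For every integer `m ≥ 1` and every `v ∈ ℝ^{4m}` each of whose four blocks of length `m`
is orthogonal to `𝟙 ∈ ℝ^m`, one has `⟨L_* v, v⟩ ≥ μ₋ ⟨v, v⟩`. -/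
theorem stmt9 (m : ℕ) (hm : 1 ≤ m) (v : Fin 4 × Fin m → ℝ)
    (hv : ∀ b : Fin 4, ∑ p, v (b, p) = 0) :
    (Lstar m).mulVec v ⬝ᵥ v ≥ muMinus m * (v ⬝ᵥ v) := by
  obtain ⟨s, hs⟩ : ∃ s, s = Real.sqrt ((m : ℝ) ^ 2 / 4 + 1) := ⟨_, rfl⟩
  have hs2 : s ^ 2 = (m : ℝ) ^ 2 / 4 + 1 := by
    rw [hs]; exact Real.sq_sqrt (by positivity)
  have hs0 : 0 ≤ s := hs ▸ Real.sqrt_nonneg _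
  have key : ∀ a b : ℝ,
      0 ≤ (s - m / 2) * a ^ 2 - 2 * a * b + (s + m / 2) * b ^ 2 := by
    intro a b
    have h : (s - m / 2) * a ^ 2 - 2 * a * b + (s + m / 2) * b ^ 2
        = (s + m / 2) * ((s - m / 2) * a - b) ^ 2 := by
      linear_combination (-(s - m / 2) * a ^ 2 + 2 * a * b) * hs2
    rw [h]; positivity
  have h0 : ∀ p, (Lstar m).mulVec v (0, p) = v (0, p) - v (1, p) := by
    intro p
    simp [Matrix.mulVec, dotProduct, Fintype.sum_prod_type, Fin.sum_univ_four, Lstar]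
    ring
  have h1 : ∀ p, (Lstar m).mulVec v (1, p) = (m + 1) * v (1, p) - v (0, p) := by
    intro p
    simp [Matrix.mulVec, dotProduct, Fintype.sum_prod_type, Fin.sum_univ_four, Lstar, hv]
    ring
  have h2 : ∀ p, (Lstar m).mulVec v (2, p) = (m + 1) * v (2, p) - v (3, p) := by
    intro p
    simp [Matrix.mulVec, dotProduct, Fintype.sum_prod_type, Fin.sum_univ_four, Lstar, hv]
    ring
  have h3 : ∀ p, (Lstar m).mulVec v (3, p) = v (3, p) - v (2, p) := by
    intro p
    simp [Matrix.mulVec, dotProduct, Fintype.sum_prod_type, Fin.sum_univ_four, Lstar]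
    ring
  rw [ge_iff_le, muMinus, ← hs]
  simp only [dotProduct, Fintype.sum_prod_type, Fin.sum_univ_four, h0, h1, h2, h3,
    ← Finset.sum_add_distrib]
  rw [Finset.mul_sum]
  apply Finset.sum_le_sum
  intro p _
  nlinarith [key (v (0, p)) (v (1, p)), key (v (3, p)) (v (2, p))]
end

section
/- Let G₁, G₂, G₃, G₄ be simple connected undirected graphs, each on m vertices, with Laplacians L₁, …, L₄, let L₀ = diag(L₁, L₂, L₃, L₄) and L = L₀ + L_*. Then for every v ∈ ℝ^{4m} each of whose four consecutive blocks of length m is orthogonal to 𝟙 ∈ ℝ^m, one has ⟨L v, v⟩ ≥ (min_{1≤k≤4} a(G_k) + μ₋) ⟨v, v⟩, where μ₋ = m/2 + 1 − √(m²/4 + 1). -/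
open Matrix Polynomial

/-- The second-smallest eigenvalue (counted with multiplicity) of a matrix, obtained as the
second entry of the nondecreasing rearrangement of the roots of its characteristic polynomial. -/
noncomputable def secondEig {N : Type*} [Fintype N] [DecidableEq N]
    (M : Matrix N N ℝ) : ℝ :=
  (M.charpoly.roots.sort (· ≤ ·)).getD 1 0

/-- The algebraic connectivity `a(G)`: the second-smallest eigenvalue of the graph Laplacian. -/
noncomputable def algConn {N : Type*} [Fintype N] [DecidableEq N]
    (G : SimpleGraph N) [DecidableRel G.Adj] : ℝ :=
  secondEig (SimpleGraph.lapMatrix ℝ G)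

theorem secondEig_le_of_cons {N : Type*} [Fintype N] [DecidableEq N]
    (M : Matrix N N ℝ) (hM : M.IsHermitian) (i0 : N)
    (hmin : ∀ i, hM.eigenvalues i0 ≤ hM.eigenvalues i) (i : N) (hi : i ≠ i0) :
    secondEig M ≤ hM.eigenvalues i := by
  classical
  have hr : M.charpoly.roots = hM.eigenvalues i0 ::ₘ
      ((Finset.univ.erase i0).val.map hM.eigenvalues) := by
    rw [hM.roots_charpoly_eq_eigenvalues, ← Multiset.map_cons,
      ← Finset.insert_val_of_notMem (Finset.notMem_erase i0 _),
      Finset.insert_erase (Finset.mem_univ _)]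
    rfl
  have hmem : hM.eigenvalues i ∈ ((Finset.univ.erase i0).val.map hM.eigenvalues).sort (· ≤ ·) := by
    rw [Multiset.mem_sort]
    exact Multiset.mem_map_of_mem _ (Finset.mem_erase.2 ⟨hi, Finset.mem_univ i⟩)
  have hs := Multiset.pairwise_sort ((Finset.univ.erase i0).val.map hM.eigenvalues) (· ≤ ·)
  unfold secondEig
  rw [hr, Multiset.sort_cons]
  · generalize ((Finset.univ.erase i0).val.map hM.eigenvalues).sort (· ≤ ·) = l at hmem hs
    cases l with
    | nil => simp at hmem
    | cons a t =>
      simp only [List.getD_cons_succ, List.getD_cons_zero]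
      rcases List.mem_cons.1 hmem with h | h
      · exact h.ge
      · exact (List.pairwise_cons.1 hs).1 _ h
  · intro b hb
    obtain ⟨j, -, rfl⟩ := Multiset.mem_map.1 hb
    exact hmin j

theorem algConn_quad {m : ℕ} (G : SimpleGraph (Fin m)) [DecidableRel G.Adj]
    (hm : 1 ≤ m) (hc : G.Connected) (w : Fin m → ℝ) (hw : ∑ p, w p = 0) :
    algConn G * (w ⬝ᵥ w) ≤ w ⬝ᵥ (G.lapMatrix ℝ *ᵥ w) := by
  classical
  have hpsd := SimpleGraph.posSemidef_lapMatrix ℝ G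
  have hM : (G.lapMatrix ℝ).IsHermitian := hpsd.1
  have hnn : ∀ i, 0 ≤ hM.eigenvalues i := hpsd.eigenvalues_nonneg
  have : Nonempty (Fin m) := ⟨⟨0, hm⟩⟩
  have hdet : (G.lapMatrix ℝ).det = 0 := SimpleGraph.det_lapMatrix_eq_zero G
  rw [hM.det_eq_prod_eigenvalues, Finset.prod_eq_zero_iff] at hdet
  obtain ⟨i0, -, h0⟩ := hdet
  have h0 : hM.eigenvalues i0 = 0 := by simpa using h0
  have hu : ∀ i, G.lapMatrix ℝ *ᵥ ⇑(hM.eigenvectorBasis i) =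
      hM.eigenvalues i • ⇑(hM.eigenvectorBasis i) := hM.mulVec_eigenvectorBasis
  have hpar : ∀ x y : Fin m → ℝ, x ⬝ᵥ y =
      ∑ i, (x ⬝ᵥ ⇑(hM.eigenvectorBasis i)) * (⇑(hM.eigenvectorBasis i) ⬝ᵥ y) := by
    intro x y
    have := hM.eigenvectorBasis.sum_inner_mul_inner (WithLp.toLp 2 x) (WithLp.toLp 2 y)
    simp only [EuclideanSpace.inner_eq_star_dotProduct, star_trivial] at this
    rw [dotProduct_comm x y, ← this]
    refine Finset.sum_congr rfl fun i _ => ?_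
    rw [dotProduct_comm x, dotProduct_comm _ y]
  have horth : ⇑(hM.eigenvectorBasis i0) ⬝ᵥ w = 0 := by
    have h := hu i0
    rw [h0, zero_smul] at h
    have h' := (SimpleGraph.lapMatrix_mulVec_eq_zero_iff_forall_reachable G).1 h
    have : ∀ p, hM.eigenvectorBasis i0 p = hM.eigenvectorBasis i0 i0 := fun p =>
      h' p i0 (hc.preconnected p i0)
    simp only [dotProduct]
    rw [Finset.sum_congr rfl (fun p _ => by rw [this p]), ← Finset.mul_sum, hw, mul_zero]
  have hL : ∀ i, ⇑(hM.eigenvectorBasis i) ⬝ᵥ (G.lapMatrix ℝ *ᵥ w) =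
      hM.eigenvalues i * (⇑(hM.eigenvectorBasis i) ⬝ᵥ w) := by
    intro i
    have hT : (G.lapMatrix ℝ)ᵀ = G.lapMatrix ℝ := SimpleGraph.isSymm_lapMatrix ..
    rw [dotProduct_mulVec, ← mulVec_transpose, hT, hu, smul_dotProduct, smul_eq_mul]
  rw [hpar w w, hpar w (_ *ᵥ w), Finset.mul_sum]
  refine Finset.sum_le_sum fun i _ => ?_
  rw [hL, dotProduct_comm w]
  by_cases hi : i = i0
  · subst hi; rw [horth]; simp
  · have := secondEig_le_of_cons _ hM i0 (fun j => by rw [h0]; exact hnn j) i hi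
    have h2 := mul_le_mul_of_nonneg_right this (mul_self_nonneg (⇑(hM.eigenvectorBasis i) ⬝ᵥ w))
    unfold algConn
    linarith

theorem muMinus_quad (m : ℕ) (x y : ℝ) :
    muMinus m * (x ^ 2 + y ^ 2) ≤ x ^ 2 - 2 * x * y + ((m : ℝ) + 1) * y ^ 2 := by
  unfold muMinus
  have hs : Real.sqrt ((m : ℝ) ^ 2 / 4 + 1) ^ 2 = (m : ℝ) ^ 2 / 4 + 1 :=
    Real.sq_sqrt (by positivity)
  have hlt : (m : ℝ) / 2 < Real.sqrt ((m : ℝ) ^ 2 / 4 + 1) :=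
    Real.lt_sqrt_of_sq_lt (by nlinarith)
  generalize Real.sqrt ((m : ℝ) ^ 2 / 4 + 1) = s at hs hlt
  generalize (m : ℝ) = r at hs hlt
  have ht : 0 < s - r / 2 := by linarith
  have h1 : (s - r / 2) * (s + r / 2) = 1 := by linear_combination hs
  have key : (s - r / 2) * ((s - r / 2) * x ^ 2 - 2 * x * y + (s + r / 2) * y ^ 2) =
      ((s - r / 2) * x - y) ^ 2 := by linear_combination y ^ 2 * h1
  have : 0 ≤ (s - r / 2) * x ^ 2 - 2 * x * y + (s + r / 2) * y ^ 2 := by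
    by_contra hneg
    push Not at hneg
    nlinarith [mul_neg_of_pos_of_neg ht hneg, sq_nonneg ((s - r / 2) * x - y)]
  linarith

theorem Lstar_quad (m : ℕ) (v : Fin 4 × Fin m → ℝ) (hv : ∀ b : Fin 4, ∑ p, v (b, p) = 0) :
    (Lstar m).mulVec v ⬝ᵥ v =
      ∑ p, ((v (0, p) ^ 2 - 2 * v (0, p) * v (1, p) + ((m : ℝ) + 1) * v (1, p) ^ 2) +
        (v (3, p) ^ 2 - 2 * v (3, p) * v (2, p) + ((m : ℝ) + 1) * v (2, p) ^ 2)) := by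
  have h : ∀ b p, (Lstar m).mulVec v (b, p) =
      ∑ c : Fin 4, ∑ q, Lstar m (b, p) (c, q) * v (c, q) := by
    intro b p; simp only [mulVec, dotProduct, Fintype.sum_prod_type]
  have e0 : ∀ p, (Lstar m).mulVec v (0, p) = v (0, p) - v (1, p) := by
    intro p; rw [h]; simp [Fin.sum_univ_four, Lstar]; ring
  have e1 : ∀ p, (Lstar m).mulVec v (1, p) = ((m : ℝ) + 1) * v (1, p) - v (0, p) := by
    intro p; rw [h]; simp [Fin.sum_univ_four, Lstar, hv]; ring
  have e2 : ∀ p, (Lstar m).mulVec v (2, p) = ((m : ℝ) + 1) * v (2, p) - v (3, p) := by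
    intro p; rw [h]; simp [Fin.sum_univ_four, Lstar, hv]; ring
  have e3 : ∀ p, (Lstar m).mulVec v (3, p) = v (3, p) - v (2, p) := by
    intro p; rw [h]; simp [Fin.sum_univ_four, Lstar]; ring
  simp only [dotProduct, Fintype.sum_prod_type, Fin.sum_univ_four, e0, e1, e2, e3,
    ← Finset.sum_add_distrib]
  exact Finset.sum_congr rfl fun p _ => by ring

theorem blockDiag4_quad {m : ℕ} (Ls : Fin 4 → Matrix (Fin m) (Fin m) ℝ)
    (v : Fin 4 × Fin m → ℝ) :
    (blockDiag4 Ls).mulVec v ⬝ᵥ v =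
      ∑ b, (fun p => v (b, p)) ⬝ᵥ (Ls b *ᵥ (fun p => v (b, p))) := by
  simp only [mulVec, dotProduct, Fintype.sum_prod_type, blockDiag4]
  refine Finset.sum_congr rfl fun b _ => Finset.sum_congr rfl fun p _ => ?_
  rw [mul_comm, Finset.sum_eq_single b]
  · simp
  · intro c _ hc; simp [hc.symm]
  · simp

/-- Let `G₁, G₂, G₃, G₄` be simple connected graphs on `m` vertices with Laplacians
`L₁, …, L₄`, let `L₀ = diag(L₁, L₂, L₃, L₄)` and `L = L₀ + L_*`.  Then for every
`v ∈ ℝ^{4m}` each of whose four blocks of length `m` is orthogonal to `𝟙 ∈ ℝ^m`,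
`⟨L v, v⟩ ≥ (minₖ a(Gₖ) + μ₋) ⟨v, v⟩`. -/
theorem stmt10 (m : ℕ) (hm : 1 ≤ m) (G : Fin 4 → SimpleGraph (Fin m))
    [∀ k, DecidableRel (G k).Adj] (hconn : ∀ k, (G k).Connected)
    (L : Matrix (Fin 4 × Fin m) (Fin 4 × Fin m) ℝ)
    (hL : L = blockDiag4 (fun k => SimpleGraph.lapMatrix ℝ (G k)) + Lstar m)
    (v : Fin 4 × Fin m → ℝ) (hv : ∀ b : Fin 4, ∑ p, v (b, p) = 0) :
    L.mulVec v ⬝ᵥ v ≥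
      (Finset.univ.inf' Finset.univ_nonempty (fun k => algConn (G k)) + muMinus m) *
        (v ⬝ᵥ v) := by
  subst hL
  set a := Finset.univ.inf' Finset.univ_nonempty (fun k => algConn (G k)) with ha
  rw [add_mulVec, add_dotProduct, blockDiag4_quad, Lstar_quad m v hv, add_mul, ge_iff_le]
  have hvv : v ⬝ᵥ v = ∑ b, (fun p => v (b, p)) ⬝ᵥ (fun p => v (b, p)) := by
    simp only [dotProduct, Fintype.sum_prod_type]
  refine add_le_add ?_ ?_
  · rw [hvv, Finset.mul_sum]
    refine Finset.sum_le_sum fun b _ => ?_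
    refine le_trans ?_ (algConn_quad (G b) hm (hconn b) _ (hv b))
    refine mul_le_mul_of_nonneg_right (Finset.inf'_le _ (Finset.mem_univ b)) ?_
    exact Finset.sum_nonneg fun p _ => mul_self_nonneg _
  · rw [hvv]
    simp only [dotProduct, Fin.sum_univ_four, ← Finset.sum_add_distrib]
    rw [Finset.mul_sum]
    refine Finset.sum_le_sum fun p _ => ?_
    have h1 := muMinus_quad m (v (0, p)) (v (1, p))
    have h2 := muMinus_quad m (v (3, p)) (v (2, p))
    linarith
end
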